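/- Let X be an integrable real random variable with E[X] ≥ 0. Then for every a > 0 and every λ > 0, E[exp(λ X + (𝔣(λa)/a) |X| 1_{|X| ≥ a})] ≥ exp((𝔣(λa)/a²) E[X² 1_{|X| ≤ a}]), where 𝔣(λ) = e^{−λ} − 1 + λ (the left-hand side is allowed to be +∞). -/

import Mathlib

open MeasureTheory Filter ProbabilityTheory Topology

noncomputable section

/-- The special function `𝔣(λ) = e^{−λ} − 1 + λ`. -/
def specialF (l : ℝ) : ℝ := Real.exp (-l) - 1 + l

theorem exp_mul_le_of_mem_unit {θ : ℝ} (h0 : 0 ≤ θ) (h1 : θ ≤ 1) (y : ℝ) :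
    Real.exp (θ * y) ≤ 1 - θ + θ * Real.exp y := by
  have h := convexOn_exp.2 (Set.mem_univ 0) (Set.mem_univ y) (sub_nonneg.2 h1) h0 (by ring)
  simpa using h

theorem specialF_hasDerivAt (x : ℝ) : HasDerivAt specialF (1 - Real.exp (-x)) x := by
  have h := (((hasDerivAt_neg x).exp).sub_const 1).add (hasDerivAt_id x)
  exact h.congr_deriv (by ring)

theorem specialF_nonneg (x : ℝ) : 0 ≤ specialF x := by
  have := Real.add_one_le_exp (-x)
  unfold specialF
  linarith

theorem specialF_le_half_sq {m : ℝ} (hm : 0 ≤ m) : specialF m ≤ m ^ 2 / 2 := by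
  have h1 := Real.quadratic_le_exp_of_nonneg hm
  have h2 : Real.exp (-m) * Real.exp m = 1 := by rw [← Real.exp_add]; simp
  have h3 := Real.exp_pos (-m)
  have h4 : Real.exp (-m) * (1 + m + m ^ 2 / 2) ≤ 1 := by nlinarith
  have h5 : 0 < 1 + m + m ^ 2 / 2 := by positivity
  have h6 : Real.exp (-m) ≤ 1 - m + m ^ 2 / 2 := by
    refine le_of_mul_le_mul_right (h4.trans ?_) h5
    nlinarith [sq_nonneg (m ^ 2)]
  unfold specialF
  linarith

theorem sq_mul_specialF_le {θ m : ℝ} (h0 : 0 ≤ θ) (h1 : θ ≤ 1) (hm : 0 ≤ m) :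
    θ ^ 2 * specialF m ≤ specialF (θ * m) := by
  have hd (x : ℝ) : HasDerivAt (fun y => specialF (θ * y) - θ ^ 2 * specialF y)
      ((1 - Real.exp (-(θ * x))) * θ - θ ^ 2 * (1 - Real.exp (-x))) x := by
    have h := (specialF_hasDerivAt (θ * x)).comp x ((hasDerivAt_id x).const_mul θ)
    simp only [mul_one] at h
    exact h.sub ((specialF_hasDerivAt x).const_mul _)
  have hmono : Monotone (fun y => specialF (θ * y) - θ ^ 2 * specialF y) := by
    refine monotone_of_hasDerivAt_nonneg hd fun x => ?_
    have h := exp_mul_le_of_mem_unit h0 h1 (-x)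
    rw [mul_neg] at h
    simp only [Pi.zero_apply]
    nlinarith
  have h := hmono hm
  simp only [specialF, mul_zero, neg_zero, Real.exp_zero] at h ⊢
  linarith

/-- A quadratic minorant of `exp` on `[-m, ∞)`, touching it at `0` and meeting it at `-m`. -/
theorem quadratic_le_exp_of_neg_le {m y : ℝ} (hm : 0 < m) (hy : -m ≤ y) :
    1 + y + specialF m / m ^ 2 * y ^ 2 ≤ Real.exp y := by
  rcases le_total 0 y with h | h
  · have h1 := Real.quadratic_le_exp_of_nonneg h
    have h2 : specialF m / m ^ 2 ≤ 1 / 2 := by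
      rw [div_le_iff₀ (by positivity)]
      linarith [specialF_le_half_sq hm.le]
    nlinarith [sq_nonneg y]
  · have h1 := sq_mul_specialF_le (θ := -y / m) (m := m) (by apply div_nonneg <;> linarith)
      (by rw [div_le_one hm]; linarith) hm.le
    rw [div_mul_cancel₀ _ hm.ne'] at h1
    have h2 : (-y / m) ^ 2 * specialF m = specialF m / m ^ 2 * y ^ 2 := by
      field_simp
    rw [h2] at h1
    simp only [specialF, neg_neg] at h1 ⊢
    linarith

theorem mul_exp_neg_half_le {m : ℝ} (hm : 0 ≤ m) :
    m * Real.exp (-(m / 2)) ≤ 1 - Real.exp (-m) := by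
  have h := Real.self_le_sinh_iff.2 (show 0 ≤ m / 2 by linarith)
  rw [Real.sinh_eq] at h
  have h1 : Real.exp (m / 2) * Real.exp (-(m / 2)) = 1 := by rw [← Real.exp_add]; simp
  have h2 : Real.exp (-(m / 2)) * Real.exp (-(m / 2)) = Real.exp (-m) := by
    rw [← Real.exp_add]
    congr 1
    ring
  nlinarith [Real.exp_pos (-(m / 2))]

theorem exp_neg_le_two_point {v μ : ℝ} (hv : 0 ≤ v) (hμ : 0 ≤ μ) :
    Real.exp (-(v * (1 - Real.exp (-μ)))) ≤ (1 + v * Real.exp (-(μ * (1 + v)))) / (1 + v) := by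
  have hv1 : 0 < 1 + v := by linarith
  have hd (x : ℝ) : HasDerivAt (fun x => (1 + v * Real.exp (-(x * (1 + v)))) / (1 + v) -
      Real.exp (-(v * (1 - Real.exp (-x)))))
      (v * Real.exp (-x) * Real.exp (-(v * (1 - Real.exp (-x)))) -
        v * Real.exp (-(x * (1 + v)))) x := by
    have h1 := ((((((hasDerivAt_id x).mul_const (1 + v)).neg).exp).const_mul v).const_add
      1).div_const (1 + v)
    have h2 := ((((hasDerivAt_neg x).exp.const_sub 1).const_mul v).neg).exp
    refine (h1.sub h2).congr_deriv ?_
    simp only [Pi.neg_apply, id_eq, one_mul]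
    field_simp
    ring
  have hmono : Monotone (fun x => (1 + v * Real.exp (-(x * (1 + v)))) / (1 + v) -
      Real.exp (-(v * (1 - Real.exp (-x))))) := by
    refine monotone_of_hasDerivAt_nonneg hd fun x => ?_
    simp only [Pi.zero_apply]
    rw [mul_assoc, ← Real.exp_add, ← mul_sub]
    refine mul_nonneg hv (sub_nonneg.2 (Real.exp_le_exp.2 ?_))
    nlinarith [Real.add_one_le_exp (-x)]
  have h := hmono hμ
  simp only [zero_mul, neg_zero, Real.exp_zero, mul_one, sub_self, mul_zero,
    div_self hv1.ne'] at h
  linarith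

theorem mul_exp_neg_le_slope {v μ : ℝ} (hv : 0 ≤ v) (hv1 : v ≤ 1) (hμ : 0 ≤ μ) :
    μ * Real.exp (-(μ * v)) ≤ μ - 2 * (specialF (μ * (1 + v)) / (1 + v) ^ 2) * v := by
  have hp : 0 < 1 + v := by linarith
  have h1 := mul_exp_neg_half_le (m := μ * (1 + v)) (by positivity)
  have h2 := exp_mul_le_of_mem_unit (θ := 2 * v / (1 + v)) (by positivity)
    (by rw [div_le_one hp]; linarith) (-(μ * (1 + v) / 2))
  have h3 : 2 * v / (1 + v) * -(μ * (1 + v) / 2) = -(μ * v) := by field_simp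
  rw [h3] at h2
  have h4 : μ - 2 * (specialF (μ * (1 + v)) / (1 + v) ^ 2) * v =
      μ * (1 - 2 * v / (1 + v)) + 2 * v / (1 + v) ^ 2 * (1 - Real.exp (-(μ * (1 + v)))) := by
    unfold specialF
    field_simp
    ring
  rw [h4]
  calc _ ≤ μ * (1 - 2 * v / (1 + v) + 2 * v / (1 + v) * Real.exp (-(μ * (1 + v) / 2))) :=
        mul_le_mul_of_nonneg_left h2 hμ
    _ = μ * (1 - 2 * v / (1 + v)) +
        2 * v / (1 + v) ^ 2 * (μ * (1 + v) * Real.exp (-(μ * (1 + v) / 2))) := by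
        field_simp
    _ ≤ _ := by gcongr

theorem truncated_quadratic_le_exp {v μ : ℝ} (hv : 0 ≤ v) (hv1 : v ≤ 1) (hμ : 0 < μ) (x : ℝ) :
    1 + μ * (x - v) + specialF (μ * (1 + v)) / (1 + v) ^ 2 *
      ((if |x| ≤ 1 then x ^ 2 else 0) - 2 * v * x + v ^ 2) ≤ Real.exp (μ * (x - v)) := by
  have hp : 0 < 1 + v := by linarith
  have hB := mul_exp_neg_le_slope hv hv1 hμ.le
  have hu : 0 ≤ specialF (μ * (1 + v)) / (1 + v) ^ 2 :=
    div_nonneg (specialF_nonneg _) (by positivity)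
  have hE : 1 - μ * (1 + v) + specialF (μ * (1 + v)) / (1 + v) ^ 2 * (1 + v) ^ 2 =
      Real.exp (-(μ * (1 + v))) := by
    rw [div_mul_cancel₀ _ (by positivity)]
    unfold specialF
    ring
  split_ifs with hx
  · have hx' := (abs_le.1 hx).1
    have h := quadratic_le_exp_of_neg_le (m := μ * (1 + v)) (y := μ * (x - v)) (by positivity)
      (by nlinarith)
    have h2 : specialF (μ * (1 + v)) / (μ * (1 + v)) ^ 2 * (μ * (x - v)) ^ 2 =
        specialF (μ * (1 + v)) / (1 + v) ^ 2 * (x ^ 2 - 2 * v * x + v ^ 2) := by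
      field_simp
      ring
    rwa [h2] at h
  · generalize specialF (μ * (1 + v)) / (1 + v) ^ 2 = u at *
    rcases lt_abs.1 (not_le.1 hx) with h | h
    · have h1 := Real.add_one_le_exp (μ * (x - v))
      have h2 : u * (0 - 2 * v * x + v ^ 2) ≤ 0 :=
        mul_nonpos_of_nonneg_of_nonpos hu (by nlinarith)
      linarith
    · have h1 : Real.exp (μ * (x - v)) =
          Real.exp (-(μ * v)) * (Real.exp (-μ) * Real.exp (-(μ * (-x - 1)))) := by
        rw [← Real.exp_add, ← Real.exp_add]
        congr 1
        ring
      have h2 : Real.exp (-(μ * (1 + v))) = Real.exp (-(μ * v)) * Real.exp (-μ) := by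
        rw [← Real.exp_add]
        congr 1
        ring
      have h3 := Real.add_one_le_exp (-(μ * (-x - 1)))
      have h4 : Real.exp (-μ) ≤ 1 := Real.exp_le_one_iff.2 (by linarith)
      have h5 : Real.exp (-μ) - μ * (-x - 1) ≤ Real.exp (-μ) * Real.exp (-(μ * (-x - 1))) := by
        have h6 : 0 ≤ μ * (-x - 1) := mul_nonneg hμ.le (by linarith)
        nlinarith [Real.exp_pos (-μ)]
      have h7 := mul_le_mul_of_nonneg_left h5 (Real.exp_pos (-(μ * v))).le
      have h8 := mul_le_mul_of_nonneg_right hB (show 0 ≤ -x - 1 by linarith)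
      rw [h1]
      nlinarith

theorem ofReal_integral_le_lintegral_ofReal {Ω : Type*} [MeasurableSpace Ω] {Pr : Measure Ω}
    {g : Ω → ℝ} (hg : Integrable g Pr) :
    ENNReal.ofReal (∫ ω, g ω ∂Pr) ≤ ∫⁻ ω, ENNReal.ofReal (g ω) ∂Pr := by
  have h := ofReal_integral_eq_lintegral_ofReal hg.pos_part
    (Eventually.of_forall fun ω => le_max_right _ _)
  calc _ ≤ ENNReal.ofReal (∫ ω, max (g ω) 0 ∂Pr) :=
        ENNReal.ofReal_le_ofReal (integral_mono hg hg.pos_part fun ω => le_max_left _ _)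
    _ = _ := by
        rw [h]
        simp

theorem exp_truncated_variance_le_lintegral_exp
    {Ω : Type*} [MeasurableSpace Ω] (Pr : Measure Ω) [IsProbabilityMeasure Pr]
    {Y : Ω → ℝ} (hint : Integrable Y Pr) (hmean : 0 ≤ ∫ ω, Y ω ∂Pr) {μ : ℝ} (hμ : 0 < μ) :
    ENNReal.ofReal (Real.exp (specialF μ * ∫ ω, (if |Y ω| ≤ 1 then Y ω ^ 2 else 0) ∂Pr)) ≤
      ∫⁻ ω, ENNReal.ofReal (Real.exp (μ * Y ω)) ∂Pr := by
  have hbd (x : ℝ) : 0 ≤ (if |x| ≤ 1 then x ^ 2 else 0) ∧ (if |x| ≤ 1 then x ^ 2 else 0) ≤ 1 := by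
    split_ifs with h
    · exact ⟨sq_nonneg x, (sq_le_one_iff_abs_le_one x).2 h⟩
    · simp
  have hmeas : Measurable fun x : ℝ => if |x| ≤ 1 then x ^ 2 else 0 :=
    Measurable.ite (measurableSet_le (by fun_prop) measurable_const) (by fun_prop)
      measurable_const
  have hT : Integrable (fun ω => if |Y ω| ≤ 1 then Y ω ^ 2 else 0) Pr := by
    refine Integrable.of_bound (hmeas.comp_aemeasurable hint.aemeasurable).aestronglyMeasurable 1
      (Eventually.of_forall fun ω => ?_)
    rw [Real.norm_eq_abs, abs_of_nonneg (hbd _).1]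
    exact (hbd _).2
  set v := ∫ ω, (if |Y ω| ≤ 1 then Y ω ^ 2 else 0) ∂Pr with hv
  have hv0 : 0 ≤ v := integral_nonneg fun ω => (hbd _).1
  have hv1 : v ≤ 1 := by
    have := integral_mono hT (integrable_const (μ := Pr) (1 : ℝ)) fun ω => (hbd (Y ω)).2
    simpa using this
  have hp : 0 < 1 + v := by linarith
  have hpt := truncated_quadratic_le_exp hv0 hv1 hμ
  have hB := mul_exp_neg_le_slope hv0 hv1 hμ.le
  have hS := exp_neg_le_two_point hv0 hμ.le
  set u := specialF (μ * (1 + v)) / (1 + v) ^ 2 with hu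
  have hg : Integrable (fun ω => Real.exp (μ * v) * ((1 - μ * v + u * v ^ 2) +
      ((μ - 2 * u * v) * Y ω + u * (if |Y ω| ≤ 1 then Y ω ^ 2 else 0)))) Pr :=
    ((integrable_const _).add ((hint.const_mul _).add (hT.const_mul _))).const_mul _
  have hgi : ∫ ω, Real.exp (μ * v) * ((1 - μ * v + u * v ^ 2) +
      ((μ - 2 * u * v) * Y ω + u * (if |Y ω| ≤ 1 then Y ω ^ 2 else 0))) ∂Pr =
      Real.exp (μ * v) * ((1 - μ * v + u * v ^ 2) +
      ((μ - 2 * u * v) * (∫ ω, Y ω ∂Pr) + u * v)) := by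
    have hsum : Integrable (fun ω => (μ - 2 * u * v) * Y ω +
        u * (if |Y ω| ≤ 1 then Y ω ^ 2 else 0)) Pr := (hint.const_mul _).add (hT.const_mul _)
    rw [integral_const_mul, integral_add (integrable_const _) hsum,
      integral_add (hint.const_mul _) (hT.const_mul _), integral_const_mul, integral_const_mul]
    simp [hv]
  have hval : 1 - μ * v + u * v ^ 2 + u * v =
      (1 + v * Real.exp (-(μ * (1 + v)))) / (1 + v) := by
    rw [hu]
    unfold specialF
    field_simp
    ring
  have hexp : Real.exp (specialF μ * v) =
      Real.exp (μ * v) * Real.exp (-(v * (1 - Real.exp (-μ)))) := by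
    rw [← Real.exp_add]
    unfold specialF
    congr 1
    ring
  refine le_trans (ENNReal.ofReal_le_ofReal ?_)
    ((ofReal_integral_le_lintegral_ofReal hg).trans
      (lintegral_mono fun ω => ENNReal.ofReal_le_ofReal ?_))
  · rw [hgi, hexp]
    have hs : 0 ≤ μ - 2 * u * v := le_trans (by positivity) hB
    refine mul_le_mul_of_nonneg_left ?_ (Real.exp_pos _).le
    nlinarith [mul_nonneg hs hmean]
  · have h1 : Real.exp (μ * Y ω) = Real.exp (μ * v) * Real.exp (μ * (Y ω - v)) := by
      rw [← Real.exp_add]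
      congr 1
      ring
    rw [h1]
    refine mul_le_mul_of_nonneg_left ?_ (Real.exp_pos _).le
    linarith [hpt (Y ω)]

/-- Key pointwise inequality: if `E[X] ≥ 0`, then for every `a > 0` and `λ > 0`,
`E[exp(λX + (𝔣(λa)/a)|X| 1_{|X|≥a})] ≥ exp((𝔣(λa)/a²) E[X² 1_{|X|≤a}])`. -/
theorem stmt5
    {Ω : Type*} [MeasurableSpace Ω] (Pr : Measure Ω) [IsProbabilityMeasure Pr]
    (X : Ω → ℝ) (hint : Integrable X Pr)
    (hmean : 0 ≤ ∫ ω, X ω ∂Pr) :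
    ∀ a : ℝ, 0 < a → ∀ l : ℝ, 0 < l →
      ENNReal.ofReal (Real.exp ((specialF (l * a) / a ^ 2) *
          ∫ ω, (if |X ω| ≤ a then X ω ^ 2 else 0) ∂Pr)) ≤
        ∫⁻ ω, ENNReal.ofReal (Real.exp (l * X ω +
          (specialF (l * a) / a) * (if a ≤ |X ω| then |X ω| else 0))) ∂Pr := by
  intro a ha l hl
  have h := exp_truncated_variance_le_lintegral_exp Pr (hint.div_const a)
    (by rw [integral_div]; exact div_nonneg hmean ha.le) (mul_pos hl ha)
  have hT (x : ℝ) : (if |x / a| ≤ 1 then (x / a) ^ 2 else 0) =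
      (if |x| ≤ a then x ^ 2 else 0) / a ^ 2 := by
    rw [abs_div, abs_of_pos ha]
    simp only [div_le_one ha]
    split_ifs
    · exact div_pow _ _ _
    · simp
  simp only [hT, integral_div] at h
  rw [div_mul_eq_mul_div, mul_div_assoc]
  refine h.trans (lintegral_mono fun ω => ENNReal.ofReal_le_ofReal (Real.exp_le_exp.2 ?_))
  have h1 : l * a * (X ω / a) = l * X ω := by field_simp
  rw [h1, le_add_iff_nonneg_right]
  refine mul_nonneg (div_nonneg (specialF_nonneg _) ha.le) ?_
  split_ifs <;> simp

end
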